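/- Let δ > -1, c = 0 and k > -1 be real numbers. Define, for 0 ≤ ρ < 1, I₁(ρ) = ∫₀¹ (1-r)^δ (1-rρ)^{-(δ+1)} (log(e/(1-ρr)))^k dr and I₂(ρ) = ∫₀¹ (1-r)^δ (1-rρ)^{-(δ+1)} (log(e(1-ρr)/(1-ρ)))^k dr. Then I₁(ρ) ≍ I₂(ρ) ≍ (log(e/(1-ρ)))^{k+1}, with implicit constants depending only on δ and k and not on ρ ∈ [0,1). -/

import Mathlib

open MeasureTheory Real

theorem aux_fun_up {a b : ℝ} (hab : a ≤ b) {g G : ℝ → ℝ} (hc : ContinuousOn G (Set.Icc a b))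
    (hd : ∀ x ∈ Set.Ioo a b, HasDerivAt G (g x) x) (h0 : ∀ x ∈ Set.Ioo a b, 0 ≤ g x) :
    ∫⁻ x in Set.Ioo a b, ENNReal.ofReal (g x) = ENNReal.ofReal (G b - G a) := by
  have hi : IntegrableOn g (Set.Ioc a b) :=
    intervalIntegral.integrableOn_deriv_of_nonneg hc hd h0
  have hi' : IntervalIntegrable g volume a b := (intervalIntegrable_iff_integrableOn_Ioc_of_le hab).2 hi
  have e := intervalIntegral.integral_eq_sub_of_hasDerivAt_of_le hab hc hd hi'
  rw [← e, intervalIntegral.integral_of_le hab, integral_Ioc_eq_integral_Ioo,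
    ofReal_integral_eq_lintegral_ofReal (hi.mono_set Set.Ioo_subset_Ioc_self)]
  filter_upwards [ae_restrict_mem measurableSet_Ioo] with x hx using h0 x hx

theorem aux_w {δ ρ r : ℝ} (h0 : 0 < 1 - r) (h1 : 0 < 1 - ρ * r) :
    (1 - r) ^ δ * (1 - r * ρ) ^ (-(δ + 1)) = ((1 - r) / (1 - ρ * r)) ^ δ / (1 - ρ * r) := by
  rw [mul_comm r ρ, div_rpow h0.le h1.le, rpow_neg h1.le, rpow_add_one h1.ne']
  have := rpow_pos_of_pos h1 δ
  field_simp

theorem aux_t {ρ r : ℝ} (h1 : 0 < 1 - ρ * r) :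
    HasDerivAt (fun r : ℝ => (1 - r) / (1 - ρ * r)) (-((1 - ρ) / (1 - ρ * r) ^ 2)) r := by
  have a : HasDerivAt (fun r : ℝ => 1 - r) (-1) r := by
    simpa using (hasDerivAt_id r).const_sub 1
  have b : HasDerivAt (fun r : ℝ => 1 - ρ * r) (-ρ) r := by
    simpa using ((hasDerivAt_id r).const_mul ρ).const_sub 1
  refine HasDerivAt.congr_deriv (a.div b h1.ne') ?_
  field_simp
  ring

theorem aux_tp {δ ρ r : ℝ} (hδ : -1 < δ) (h0 : 0 < 1 - r) (h1 : 0 < 1 - ρ * r) :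
    HasDerivAt (fun r : ℝ => ((1 - r) / (1 - ρ * r)) ^ (δ + 1))
      (-((δ + 1) * ((1 - r) / (1 - ρ * r)) ^ δ * ((1 - ρ) / (1 - ρ * r) ^ 2))) r := by
  have := (aux_t h1).rpow_const (p := δ + 1) (Or.inl (div_pos h0 h1).ne')
  convert this using 1
  rw [add_sub_cancel_right]; ring

theorem aux_u1 {ρ r : ℝ} (h1 : 0 < 1 - ρ * r) :
    HasDerivAt (fun r : ℝ => Real.log (Real.exp 1 / (1 - ρ * r))) (1 * (ρ / (1 - ρ * r))) r := by
  have b : HasDerivAt (fun r : ℝ => 1 - ρ * r) (-ρ) r := by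
    simpa using ((hasDerivAt_id r).const_mul ρ).const_sub 1
  have c0 : HasDerivAt (fun r : ℝ => Real.exp 1 / (1 - ρ * r)) _ r :=
    (hasDerivAt_const r (Real.exp 1)).div b h1.ne'
  refine HasDerivAt.congr_deriv (c0.log (by positivity)) ?_
  field_simp
  ring

theorem aux_u2 {ρ r : ℝ} (h : 0 < 1 - ρ) (h1 : 0 < 1 - ρ * r) :
    HasDerivAt (fun r : ℝ => Real.log (Real.exp 1 * (1 - ρ * r) / (1 - ρ)))
      ((-1) * (ρ / (1 - ρ * r))) r := by
  have b : HasDerivAt (fun r : ℝ => 1 - ρ * r) (-ρ) r := by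
    simpa using ((hasDerivAt_id r).const_mul ρ).const_sub 1
  have c := ((b.const_mul (Real.exp 1)).div_const (1 - ρ)).log (by positivity)
  convert c using 1
  field_simp

theorem aux_pos {ρ r : ℝ} (h0 : 0 ≤ ρ) (h : ρ < 1) (hr : r ≤ 1) : 1 - ρ ≤ 1 - ρ * r := by
  nlinarith

theorem aux_L {ρ : ℝ} (h : ρ < 1) : Real.log (Real.exp 1 / (1 - ρ)) = 1 - Real.log (1 - ρ) := by
  rw [Real.log_div (Real.exp_pos 1).ne' (by linarith), Real.log_exp]

theorem aux_u1e {ρ r : ℝ} (h : 0 < 1 - ρ * r) :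
    Real.log (Real.exp 1 / (1 - ρ * r)) = 1 - Real.log (1 - ρ * r) := by
  rw [Real.log_div (Real.exp_pos 1).ne' h.ne', Real.log_exp]

theorem aux_u2e {ρ r : ℝ} (h : ρ < 1) (h1 : 0 < 1 - ρ * r) :
    Real.log (Real.exp 1 * (1 - ρ * r) / (1 - ρ)) = 1 + Real.log (1 - ρ * r) - Real.log (1 - ρ) := by
  rw [Real.log_div (by positivity) (by linarith), Real.log_mul (by positivity) h1.ne', Real.log_exp]

theorem aux_tc {δ ρ a : ℝ} (hδ : -1 < δ) (h0 : 0 ≤ ρ) (h : ρ < 1) :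
    ContinuousOn (fun r : ℝ => ((1 - r) / (1 - ρ * r)) ^ (δ + 1)) (Set.Icc a 1) := by
  apply ContinuousOn.rpow_const
  · apply ContinuousOn.div (by fun_prop) (by fun_prop)
    intro x hx
    have := aux_pos h0 h hx.2
    linarith
  · intro x hx; right; linarith

/-- upper bound -/
theorem aux_upper {δ k ρ L ε : ℝ} (hδ : -1 < δ) (hk : -1 < k) (h0 : 0 ≤ ρ) (h : ρ < 1)
    (u : ℝ → ℝ) (hε : ε = 1 ∨ ε = -1)
    (hu1 : ∀ r ∈ Set.Icc (0:ℝ) 1, 1 ≤ u r) (huL : ∀ r ∈ Set.Icc (0:ℝ) 1, u r ≤ L)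
    (hd : ∀ r ∈ Set.Icc (0:ℝ) 1, HasDerivAt u (ε * (ρ / (1 - ρ * r))) r) :
    ∫⁻ r in Set.Ioo (0:ℝ) 1, ENNReal.ofReal ((1 - r) ^ δ * (1 - r * ρ) ^ (-(δ + 1)) * u r ^ k) ≤
      ENNReal.ofReal ((1 / (δ + 1) + 1 / (k + 1)) * L ^ (k + 1)) := by
  have hδ' : 0 < δ + 1 := by linarith
  have hk' : 0 < k + 1 := by linarith
  have hL : 1 ≤ L := (hu1 0 (by simp)).trans (huL 0 (by simp))
  have hL0 : 0 ≤ L ^ (k + 1) := by positivity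
  have hub : ∀ r ∈ Set.Icc (0:ℝ) 1, u r ^ k ≤ L ^ (k + 1) := by
    intro r hr
    have a := hu1 r hr
    calc u r ^ k ≤ u r ^ (k + 1) := rpow_le_rpow_of_exponent_le a (by linarith)
      _ ≤ _ := rpow_le_rpow (by linarith) (huL r hr) hk'.le
  have hee : ε * ε = 1 := by rcases hε with rfl | rfl <;> norm_num
  have key := aux_fun_up (zero_le_one' ℝ)
    (G := fun r => -(L ^ (k + 1) / (δ + 1)) * ((1 - r) / (1 - ρ * r)) ^ (δ + 1)
      + ε / (k + 1) * u r ^ (k + 1))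
    (g := fun r => L ^ (k + 1) * (((1 - r) / (1 - ρ * r)) ^ δ * ((1 - ρ) / (1 - ρ * r) ^ 2))
      + u r ^ k * (ρ / (1 - ρ * r))) ?_ ?_ ?_
  · refine le_trans ?_ (key.le.trans ?_)
    · refine setLIntegral_mono' measurableSet_Ioo fun r hr => ENNReal.ofReal_le_ofReal ?_
      have p1 : 0 < 1 - r := by linarith [hr.2]
      have p2 : 0 < 1 - ρ * r := by linarith [aux_pos h0 h hr.2.le]
      rw [aux_w p1 p2]
      set D := 1 - ρ * r with hD
      set t := (1 - r) / D with ht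
      have tp : 0 < t := div_pos p1 p2
      have t1 : t ≤ 1 := by rw [ht, div_le_one p2]; nlinarith [hr.1]
      have tt : t ^ δ * t ≤ 1 := by
        rw [← rpow_add_one tp.ne']; exact rpow_le_one tp.le t1 hδ'.le
      have hr' : r ∈ Set.Icc (0:ℝ) 1 := ⟨hr.1.le, hr.2.le⟩
      have a := hub r hr'
      have up : 0 < u r ^ k := rpow_pos_of_pos (by linarith [hu1 r hr']) k
      have e : t ^ δ / D * u r ^ k = u r ^ k * (t ^ δ * ((1 - ρ) / D ^ 2)) + u r ^ k * (t ^ δ * t * (ρ / D)) := by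
        have : t * D = 1 - r := by rw [ht]; field_simp
        have h3 : 1 = (1 - ρ) / D + ρ * t := by
          rw [ht]; field_simp; rw [hD]; ring
        calc t ^ δ / D * u r ^ k = t ^ δ / D * u r ^ k * ((1 - ρ) / D + ρ * t) := by rw [← h3, mul_one]
          _ = _ := by ring
      rw [e]
      have q1 : 0 ≤ t ^ δ * ((1 - ρ) / D ^ 2) := by
        have : 0 ≤ 1 - ρ := by linarith
        positivity
      have q2 : 0 ≤ ρ / D := by positivity
      refine add_le_add (mul_le_mul_of_nonneg_right a q1) ?_
      refine mul_le_mul_of_nonneg_left ?_ up.le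
      nlinarith
    · apply ENNReal.ofReal_le_ofReal
      simp only [sub_self, zero_div, zero_rpow hδ'.ne', mul_zero, sub_zero, div_one, one_rpow]
      have h1 : ∀ r ∈ Set.Icc (0:ℝ) 1, 0 ≤ u r ^ (k + 1) ∧ u r ^ (k + 1) ≤ L ^ (k + 1) := fun r hr =>
        ⟨rpow_nonneg (by linarith [hu1 r hr]) _,
          rpow_le_rpow (by linarith [hu1 r hr]) (huL r hr) hk'.le⟩
      have a0 := h1 0 (by simp)
      have a1 := h1 1 (by simp)
      have : ε * (u 1 ^ (k + 1) - u 0 ^ (k + 1)) ≤ L ^ (k + 1) := by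
        rcases hε with rfl | rfl <;> linarith
      have := div_le_div_of_nonneg_right this hk'.le
      calc _ = L ^ (k + 1) / (δ + 1) + ε * (u 1 ^ (k + 1) - u 0 ^ (k + 1)) / (k + 1) := by ring
        _ ≤ L ^ (k + 1) / (δ + 1) + L ^ (k + 1) / (k + 1) := by linarith
        _ = _ := by ring
  · refine (continuousOn_const.mul (aux_tc hδ h0 h)).add (continuousOn_const.mul ?_)
    refine ContinuousOn.rpow_const (fun x hx => (hd x hx).continuousAt.continuousWithinAt) ?_
    intro x hx; right; exact hk'.le
  · intro r hr
    have p1 : 0 < 1 - r := by linarith [hr.2]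
    have p2 : 0 < 1 - ρ * r := by linarith [aux_pos h0 h hr.2.le]
    have hr' : r ∈ Set.Icc (0:ℝ) 1 := ⟨hr.1.le, hr.2.le⟩
    have a := ((aux_tp hδ p1 p2).const_mul (-(L ^ (k + 1) / (δ + 1)))).add
      (((hd r hr').rpow_const (p := k + 1) (Or.inl (by linarith [hu1 r hr']))).const_mul (ε / (k + 1)))
    refine HasDerivAt.congr_deriv a ?_
    rw [add_sub_cancel_right]
    have : ε / (k + 1) * (ε * (ρ / (1 - ρ * r)) * (k + 1) * u r ^ k) =
       (ε * ε) * (u r ^ k * (ρ / (1 - ρ * r))) := by field_simp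
    rw [this, hee, one_mul]
    field_simp
  · intro r hr
    have p1 : 0 < 1 - r := by linarith [hr.2]
    have p2 : 0 < 1 - ρ * r := by linarith [aux_pos h0 h hr.2.le]
    have hr' : r ∈ Set.Icc (0:ℝ) 1 := ⟨hr.1.le, hr.2.le⟩
    have up : 0 < u r ^ k := rpow_pos_of_pos (by linarith [hu1 r hr']) k
    have : 0 ≤ 1 - ρ := by linarith
    positivity

theorem aux_lower {δ k ρ a : ℝ} (hδ : -1 < δ) (hk : -1 < k) (h0 : 0 ≤ ρ) (h : ρ < 1)
    (ha0 : 0 ≤ a) (ha : a ≤ 1) :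
    ENNReal.ofReal (1 / (δ + k + 2) * ((1 - a) / (1 - ρ * a)) ^ (δ + 1) *
        Real.log (Real.exp 1 * (1 - ρ * a) / (1 - ρ)) ^ (k + 1)) ≤
    ∫⁻ r in Set.Ioo a 1, ENNReal.ofReal ((1 - r) ^ δ * (1 - r * ρ) ^ (-(δ + 1)) *
      Real.log (Real.exp 1 * (1 - ρ * r) / (1 - ρ)) ^ k) := by
  have hδ' : 0 < δ + 1 := by linarith
  have hk' : 0 < k + 1 := by linarith
  have hC : 0 < δ + k + 2 := by linarith
  have hρ : 0 < 1 - ρ := by linarith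
  have hu1 : ∀ r ≤ 1, 1 ≤ Real.log (Real.exp 1 * (1 - ρ * r) / (1 - ρ)) := by
    intro r hr
    have := aux_pos h0 h hr
    rw [aux_u2e h (by linarith)]
    linarith [Real.log_le_log hρ this]
  have key := aux_fun_up ha
    (G := fun r => -(1 / (δ + k + 2)) * (((1 - r) / (1 - ρ * r)) ^ (δ + 1) *
      Real.log (Real.exp 1 * (1 - ρ * r) / (1 - ρ)) ^ (k + 1)))
    (g := fun r => 1 / (δ + k + 2) * (
      (δ + 1) * ((1 - r) / (1 - ρ * r)) ^ δ * ((1 - ρ) / (1 - ρ * r) ^ 2) *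
        Real.log (Real.exp 1 * (1 - ρ * r) / (1 - ρ)) ^ (k + 1) +
      ((1 - r) / (1 - ρ * r)) ^ (δ + 1) *
        ((k + 1) * Real.log (Real.exp 1 * (1 - ρ * r) / (1 - ρ)) ^ k * (ρ / (1 - ρ * r))))) ?_ ?_ ?_
  · refine le_trans ?_ (key.ge.trans ?_)
    · apply ENNReal.ofReal_le_ofReal
      simp only [sub_self, zero_div, zero_rpow hδ'.ne', mul_zero, zero_mul]
      apply le_of_eq; ring
    · refine setLIntegral_mono' measurableSet_Ioo fun r hr => ENNReal.ofReal_le_ofReal ?_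
      have p1 : 0 < 1 - r := by linarith [hr.2]
      have p2 : 0 < 1 - ρ * r := by linarith [aux_pos h0 h hr.2.le]
      have hu := hu1 r hr.2.le
      have hy : Real.log (Real.exp 1 * (1 - ρ * r) / (1 - ρ)) ≤ (1 - ρ * r) / (1 - ρ) := by
        rw [mul_div_assoc, Real.log_mul (by positivity) (by positivity), Real.log_exp]
        linarith [Real.log_le_sub_one_of_pos (div_pos p2 hρ)]
      rw [aux_w p1 p2]
      set u := Real.log (Real.exp 1 * (1 - ρ * r) / (1 - ρ))
      set D := 1 - ρ * r with hD
      set t := (1 - r) / D with ht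
      have tp : 0 < t := div_pos p1 p2
      have t1 : t ≤ 1 := by rw [ht, div_le_one p2]; nlinarith [hr.1]
      rw [rpow_add_one tp.ne', rpow_add_one (by linarith : u ≠ 0)]
      have hy' : (1 - ρ) / D * u ≤ 1 := by
        rw [le_div_iff₀ hρ] at hy
        rw [div_mul_eq_mul_div, div_le_one p2]; linarith
      have ht' : t * ρ ≤ 1 := by nlinarith
      have W : 0 ≤ t ^ δ / D * u ^ k := by
        have : 0 ≤ u := by linarith
        positivity
      calc _ = 1 / (δ + k + 2) * (t ^ δ / D * u ^ k * ((δ + 1) * ((1 - ρ) / D * u) + (k + 1) * (t * ρ))) := by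
            ring
        _ ≤ 1 / (δ + k + 2) * (t ^ δ / D * u ^ k * ((δ + 1) * 1 + (k + 1) * 1)) := by gcongr
        _ = _ := by field_simp; ring
  · refine continuousOn_const.mul ((aux_tc hδ h0 h).mul ?_)
    refine ContinuousOn.rpow_const (fun x hx => (aux_u2 hρ ?_).continuousAt.continuousWithinAt) ?_
    · linarith [aux_pos h0 h hx.2]
    intro x hx; right; exact hk'.le
  · intro r hr
    have p1 : 0 < 1 - r := by linarith [hr.2]
    have p2 : 0 < 1 - ρ * r := by linarith [aux_pos h0 h hr.2.le]
    have b := ((aux_tp hδ p1 p2).mul ((aux_u2 hρ p2).rpow_const (p := k + 1)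
      (Or.inl (by linarith [hu1 r hr.2.le])))).const_mul (-(1 / (δ + k + 2)))
    refine HasDerivAt.congr_deriv b ?_
    rw [add_sub_cancel_right]
    ring
  · intro r hr
    have p1 : 0 < 1 - r := by linarith [hr.2]
    have p2 : 0 < 1 - ρ * r := by linarith [aux_pos h0 h hr.2.le]
    have hu : 0 ≤ Real.log (Real.exp 1 * (1 - ρ * r) / (1 - ρ)) := by linarith [hu1 r hr.2.le]
    positivity

theorem aux_lower1 {δ k ρ : ℝ} (hδ : -1 < δ) (h0 : 0 ≤ ρ) (h : ρ < 1) :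
    ENNReal.ofReal ((1 / 2) ^ |k| * (1 / (δ + 2) * (1 / 2) ^ (δ + 1) * (1 / 2)) *
        Real.log (Real.exp 1 / (1 - ρ)) ^ (k + 1)) ≤
    ∫⁻ r in Set.Ioo (0:ℝ) 1, ENNReal.ofReal ((1 - r) ^ δ * (1 - r * ρ) ^ (-(δ + 1)) *
      Real.log (Real.exp 1 / (1 - ρ * r)) ^ k) := by
  have hδ' : 0 < δ + 1 := by linarith
  have hδ2 : 0 < δ + 2 := by linarith
  have hρ : 0 < 1 - ρ := by linarith
  set s := Real.sqrt (1 - ρ) with hs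
  have sp : 0 < s := Real.sqrt_pos.2 hρ
  have ss : s * s = 1 - ρ := Real.mul_self_sqrt hρ.le
  have s1 : s ≤ 1 := by nlinarith
  set a := 1 / (1 + s) with ha
  have ap : 0 < a := by positivity
  have a1 : a ≤ 1 := by rw [ha, div_le_one (by positivity)]; linarith
  have a2 : 1 / 2 ≤ a := by rw [ha]; gcongr; linarith
  have as : a * (1 + s) = 1 := by rw [ha]; field_simp
  have e1 : 1 - ρ * a = s := by
    have : ρ = 1 - s * s := by linarith
    rw [this]; linear_combination (-(1 - s)) * as
  have e2 : (1 - a) / (1 - ρ * a) = a := by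
    rw [e1, div_eq_iff sp.ne']; linarith
  have ls : Real.log (1 - ρ) = 2 * Real.log s := by
    rw [← ss, Real.log_mul sp.ne' sp.ne']; ring
  have low := aux_lower (k := 0) (a := a) hδ (by norm_num) h0 h ap.le a1
  have hL := aux_L h
  set L := Real.log (Real.exp 1 / (1 - ρ))
  have hl : Real.log s ≤ 0 := Real.log_nonpos sp.le s1
  have hL1 : 1 ≤ L := by linarith
  rw [e2, aux_u2e h (by rw [e1]; exact sp), e1] at low
  simp only [add_zero, zero_add, rpow_one, rpow_zero, mul_one] at low
  set c := (1 / 2 : ℝ) ^ |k| * L ^ k with hc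
  have c0 : 0 ≤ c := by positivity
  calc _ ≤ ENNReal.ofReal (c * (1 / (δ + 2) * a ^ (δ + 1) * (1 + Real.log s - Real.log (1 - ρ)))) := by
        apply ENNReal.ofReal_le_ofReal
        have : (1 / 2 : ℝ) ^ (δ + 1) ≤ a ^ (δ + 1) := by gcongr
        have hh : 1 / 2 * L ≤ 1 + Real.log s - Real.log (1 - ρ) := by linarith
        rw [rpow_add_one (by linarith : L ≠ 0)]
        calc _ = c * (1 / (δ + 2) * (1 / 2) ^ (δ + 1) * (1 / 2 * L)) := by rw [hc]; ring
          _ ≤ _ := by gcongr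
    _ = ENNReal.ofReal c * ENNReal.ofReal (1 / (δ + 2) * a ^ (δ + 1) * (1 + Real.log s - Real.log (1 - ρ))) :=
        ENNReal.ofReal_mul c0
    _ ≤ ENNReal.ofReal c * ∫⁻ r in Set.Ioo a 1, ENNReal.ofReal ((1 - r) ^ δ * (1 - r * ρ) ^ (-(δ + 1))) := by
        gcongr
    _ = ∫⁻ r in Set.Ioo a 1, ENNReal.ofReal c * ENNReal.ofReal ((1 - r) ^ δ * (1 - r * ρ) ^ (-(δ + 1))) :=
        (lintegral_const_mul' _ _ ENNReal.ofReal_ne_top).symm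
    _ ≤ ∫⁻ r in Set.Ioo a 1, ENNReal.ofReal ((1 - r) ^ δ * (1 - r * ρ) ^ (-(δ + 1)) *
          Real.log (Real.exp 1 / (1 - ρ * r)) ^ k) := by
        refine setLIntegral_mono' measurableSet_Ioo fun r hr => ?_
        rw [← ENNReal.ofReal_mul c0]
        apply ENNReal.ofReal_le_ofReal
        have p1 : 0 < 1 - r := by linarith [hr.2]
        have p3 := aux_pos h0 h hr.2.le
        have p2 : 0 < 1 - ρ * r := by linarith
        have p4 : 1 - ρ * r ≤ s := by rw [← e1]; nlinarith [hr.1]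
        rw [aux_w p1 p2, aux_u1e p2, mul_comm]
        have l1 := Real.log_le_log p2 p4
        have l2 := Real.log_le_log hρ p3
        refine mul_le_mul_of_nonneg_left ?_ (by positivity)
        set u := 1 - Real.log (1 - ρ * r)
        have u1 : 1 / 2 * L ≤ u := by linarith
        have u2 : u ≤ L := by linarith
        rcases le_total 0 k with hk | hk
        · rw [hc, abs_of_nonneg hk, ← mul_rpow (by norm_num) (by linarith)]
          exact rpow_le_rpow (by linarith) u1 hk
        · have : L ^ k ≤ u ^ k := rpow_le_rpow_of_nonpos (by linarith) u2 hk
          have h2 : (1 / 2 : ℝ) ^ |k| ≤ 1 := rpow_le_one (by norm_num) (by norm_num) (abs_nonneg k)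
          have h3 : 0 ≤ L ^ k := by positivity
          rw [hc]; nlinarith
    _ ≤ _ := lintegral_mono_set (Set.Ioo_subset_Ioo_left ap.le)

/-- **Lemma 2.1 (3).** For `δ > -1`, `c = 0` and `k > -1`,
`I₁(ρ) = ∫₀¹ (1-r)^δ (1-rρ)^{-(δ+1)} (log(e/(1-ρr)))^k dr` and
`I₂(ρ) = ∫₀¹ (1-r)^δ (1-rρ)^{-(δ+1)} (log(e(1-ρr)/(1-ρ)))^k dr`
are both comparable to `(log(e/(1-ρ)))^{k+1}` uniformly for `ρ ∈ [0,1)`. -/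
theorem lemma21_case3 (δ k : ℝ) (hδ : -1 < δ) (hk : -1 < k) :
    ∃ A₁ A₂ : ℝ, 0 < A₁ ∧ 0 < A₂ ∧ ∀ ρ : ℝ, 0 ≤ ρ → ρ < 1 →
      (ENNReal.ofReal (A₁ * Real.log (Real.exp 1 / (1 - ρ)) ^ (k + 1)) ≤
          ∫⁻ r in Set.Ioo (0:ℝ) 1,
            ENNReal.ofReal ((1 - r) ^ δ * (1 - r * ρ) ^ (-(δ + 1)) *
              Real.log (Real.exp 1 / (1 - ρ * r)) ^ k)) ∧
      ((∫⁻ r in Set.Ioo (0:ℝ) 1,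
            ENNReal.ofReal ((1 - r) ^ δ * (1 - r * ρ) ^ (-(δ + 1)) *
              Real.log (Real.exp 1 / (1 - ρ * r)) ^ k)) ≤
        ENNReal.ofReal (A₂ * Real.log (Real.exp 1 / (1 - ρ)) ^ (k + 1))) ∧
      (ENNReal.ofReal (A₁ * Real.log (Real.exp 1 / (1 - ρ)) ^ (k + 1)) ≤
          ∫⁻ r in Set.Ioo (0:ℝ) 1,
            ENNReal.ofReal ((1 - r) ^ δ * (1 - r * ρ) ^ (-(δ + 1)) *
              Real.log (Real.exp 1 * (1 - ρ * r) / (1 - ρ)) ^ k)) ∧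
      ((∫⁻ r in Set.Ioo (0:ℝ) 1,
            ENNReal.ofReal ((1 - r) ^ δ * (1 - r * ρ) ^ (-(δ + 1)) *
              Real.log (Real.exp 1 * (1 - ρ * r) / (1 - ρ)) ^ k)) ≤
        ENNReal.ofReal (A₂ * Real.log (Real.exp 1 / (1 - ρ)) ^ (k + 1))) := by
  have hδ' : 0 < δ + 1 := by linarith
  have hδ2 : 0 < δ + 2 := by linarith
  have hk' : 0 < k + 1 := by linarith
  have hC : 0 < δ + k + 2 := by linarith
  refine ⟨min (1 / (δ + k + 2)) ((1 / 2) ^ |k| * (1 / (δ + 2) * (1 / 2) ^ (δ + 1) * (1 / 2))),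
    1 / (δ + 1) + 1 / (k + 1), lt_min (by positivity) (by positivity), by positivity, ?_⟩
  intro ρ h0 h
  have hρ : 0 < 1 - ρ := by linarith
  have hL : 0 ≤ Real.log (Real.exp 1 / (1 - ρ)) ^ (k + 1) := by
    apply rpow_nonneg
    rw [aux_L h]
    linarith [Real.log_nonpos hρ.le (by linarith)]
  have hb : ∀ r ∈ Set.Icc (0:ℝ) 1, 0 < 1 - ρ * r ∧ Real.log (1 - ρ) ≤ Real.log (1 - ρ * r) ∧
      Real.log (1 - ρ * r) ≤ 0 := by
    intro r hr
    have p := aux_pos h0 h hr.2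
    have p2 : 0 < 1 - ρ * r := by linarith
    exact ⟨p2, Real.log_le_log hρ p, Real.log_nonpos p2.le (by nlinarith [hr.1])⟩
  refine ⟨?_, ?_, ?_, ?_⟩
  · refine le_trans (ENNReal.ofReal_le_ofReal ?_) (aux_lower1 hδ h0 h)
    exact mul_le_mul_of_nonneg_right (min_le_right _ _) hL
  · refine aux_upper (ε := 1) hδ hk h0 h (fun r => Real.log (Real.exp 1 / (1 - ρ * r)))
      (Or.inl rfl) ?_ ?_ ?_ <;> intro r hr <;> obtain ⟨b1, b2, b3⟩ := hb r hr
    · simp only [aux_u1e b1]; linarith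
    · simp only [aux_u1e b1, aux_L h]; linarith
    · exact aux_u1 b1
  · have low := aux_lower (a := 0) hδ hk h0 h le_rfl zero_le_one
    refine le_trans (ENNReal.ofReal_le_ofReal ?_) low
    simp only [mul_zero, sub_zero, div_one, one_rpow, mul_one]
    exact mul_le_mul_of_nonneg_right (min_le_left _ _) hL
  · refine aux_upper (ε := -1) hδ hk h0 h (fun r => Real.log (Real.exp 1 * (1 - ρ * r) / (1 - ρ)))
      (Or.inr rfl) ?_ ?_ ?_ <;> intro r hr <;> obtain ⟨b1, b2, b3⟩ := hb r hr
    · simp only [aux_u2e h b1]; linarith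
    · simp only [aux_u2e h b1, aux_L h]; linarith
    · exact aux_u2 hρ b1
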